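/- Khasminskii's exponential estimate: Under the setting of the previous lemma (nondecreasing continuous adapted A with E[A_t - A_s | F_s] ≤ C(t-s)^β for all t₀ ≤ s ≤ t ≤ t₁), for every λ > 0, E[exp(λ A_{t₁}) | F_{t₀}] ≤ 2^{(t₁-t₀)(2Cλ)^{1/β} + 1} almost surely. In particular if one chooses n ∈ N with λC((t₁-t₀)/n)^β ≤ 1/2 then E[exp(λ A_{t₁}) | F_{t₀}] ≤ 2^n. -/

import Mathlib

open MeasureTheory

lemma kh_ind_real {Ω : Type*} {m : MeasurableSpace Ω} {B : Set Ω} (hB : MeasurableSet B) :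
    Measurable (B.indicator (1 : Ω → ℝ)) := Measurable.indicator measurable_one hB

lemma kh_ind_ennreal {Ω : Type*} {m : MeasurableSpace Ω} {B : Set Ω} (hB : MeasurableSet B) :
    Measurable (B.indicator (1 : Ω → ENNReal)) := Measurable.indicator measurable_one hB

lemma kh_condexp {Ω : Type*} (m : MeasurableSpace Ω) {m0 : MeasurableSpace Ω} (P : Measure Ω)
    [IsProbabilityMeasure P] (hm : m ≤ m0) (f D : Ω → ℝ) (c K : ℝ)
    (hf : Measurable[m] f) (hf0 : ∀ ω, 0 ≤ f ω) (hfc : ∀ ω, f ω ≤ c)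
    (hD : Integrable D P) (hK : ∀ᵐ ω ∂P, (P[D|m]) ω ≤ K) :
    ∫ ω, f ω * D ω ∂P ≤ K * ∫ ω, f ω ∂P := by
  have hfm : AEStronglyMeasurable f P := (hf.mono hm le_rfl).aestronglyMeasurable
  have hb : ∀ᵐ ω ∂P, ‖f ω‖ ≤ c := Filter.Eventually.of_forall fun ω => by
    rw [Real.norm_eq_abs, abs_of_nonneg (hf0 ω)]; exact hfc ω
  have hfi : Integrable f P := Integrable.of_bound hfm c hb
  have hfD : Integrable (f * D) P := hD.bdd_mul hfm hb
  have h1 : P[f * D|m] =ᵐ[P] f * P[D|m] :=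
    condExp_mul_of_stronglyMeasurable_left hf.stronglyMeasurable hfD hD
  have h2 : ∫ ω, f ω * D ω ∂P = ∫ ω, (f * P[D|m]) ω ∂P := by
    rw [← integral_congr_ae h1, integral_condExp hm]; rfl
  rw [h2, ← integral_const_mul]
  apply integral_mono_ae
  · exact (integrable_condExp).bdd_mul hfm hb
  · exact hfi.const_mul K
  · filter_upwards [hK] with ω hω
    have := mul_le_mul_of_nonneg_left hω (hf0 ω)
    simp only [Pi.mul_apply]; linarith

lemma kh_discrete {Ω : Type*} {m0 : MeasurableSpace Ω} (P : Measure Ω) [IsProbabilityMeasure P]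
    (G : ℕ → MeasurableSpace Ω) (hG : ∀ i, G i ≤ m0) (hG0 : ∀ i, G 0 ≤ G i)
    (hG1 : ∀ i, G i ≤ G (i+1))
    (N : ℕ) (b : ℕ → Ω → ℝ) (M K : ℝ) (w : Ω → ℝ)
    (hw : Measurable[G 0] w) (hw0 : ∀ ω, 0 ≤ w ω) (hw1 : ∀ ω, w ω ≤ 1)
    (hb : ∀ i, Measurable[G i] (b i)) (hbz : ∀ ω, b 0 ω = 0) (hb0 : ∀ i ω, 0 ≤ b i ω)
    (hbM : ∀ i ω, b i ω ≤ M)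
    (hmono : ∀ i ω, b i ω ≤ b (i+1) ω)
    (hK : ∀ i ≤ N, ∀ f : Ω → ℝ, Measurable[G i] f → (∀ ω, 0 ≤ f ω) → (∀ ω, f ω ≤ Real.exp M) →
      ∫ ω, f ω * (b N ω - b i ω) ∂P ≤ K * ∫ ω, f ω ∂P) :
    ∫ ω, w ω * ∑ i ∈ Finset.range N, Real.exp (b i ω) * (b (i+1) ω - b i ω) ∂P
      ≤ K * ∫ ω, w ω * Real.exp (b N ω) ∂P := by
  have hbm : ∀ i, Measurable (b i) := fun i => (hb i).mono (hG i) le_rfl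
  have hwm : Measurable w := hw.mono (hG 0) le_rfl
  have hwb : ∀ᵐ ω ∂P, ‖w ω‖ ≤ 1 := Filter.Eventually.of_forall fun ω => by
    rw [Real.norm_eq_abs, abs_of_nonneg (hw0 ω)]; exact hw1 ω
  have hdi : ∀ i j, Integrable (fun ω => b i ω - b j ω) P := fun i j => by
    have : ∀ i, Integrable (b i) P := fun i =>
      Integrable.of_bound (hbm i).aestronglyMeasurable M (Filter.Eventually.of_forall fun ω => by
        rw [Real.norm_eq_abs, abs_of_nonneg (hb0 i ω)]; exact hbM i ω)
    exact (this i).sub (this j)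
  have hei : ∀ i, Integrable (fun ω => Real.exp (b i ω)) P := fun i =>
    Integrable.of_bound (hbm i).exp.aestronglyMeasurable (Real.exp M)
      (Filter.Eventually.of_forall fun ω => by
        rw [Real.norm_eq_abs, abs_of_nonneg (Real.exp_pos _).le]
        exact Real.exp_le_exp.2 (hbM i ω))
  have hedi : ∀ i j k, Integrable (fun ω => Real.exp (b i ω) * (b j ω - b k ω)) P := fun i j k =>
    (hdi j k).bdd_mul (c := Real.exp M) (hbm i).exp.aestronglyMeasurable
      (Filter.Eventually.of_forall fun ω => by
        rw [Real.norm_eq_abs, abs_of_nonneg (Real.exp_pos _).le]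
        exact Real.exp_le_exp.2 (hbM i ω))
  have hwe : ∀ i, Integrable (fun ω => w ω * Real.exp (b i ω)) P := fun i =>
    (hei i).bdd_mul hwm.aestronglyMeasurable hwb
  have hTi : ∀ n, Integrable (fun ω => w ω * ((∑ i ∈ Finset.range n,
      Real.exp (b i ω) * (b (i+1) ω - b i ω)) + Real.exp (b n ω) * (b N ω - b n ω))) P := fun n => by
    refine Integrable.bdd_mul (c := 1) ?_ hwm.aestronglyMeasurable hwb
    exact (integrable_finsetSum _ fun i _ => hedi i (i+1) i).add (hedi n N n)
  have key : ∀ n ≤ N, ∫ ω, w ω * ((∑ i ∈ Finset.range n,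
      Real.exp (b i ω) * (b (i+1) ω - b i ω)) + Real.exp (b n ω) * (b N ω - b n ω)) ∂P
      ≤ K * ∫ ω, w ω * Real.exp (b n ω) ∂P := by
    intro n
    induction n with
    | zero =>
      intro hn
      have hM : 1 ≤ Real.exp M := by
        rcases isEmpty_or_nonempty Ω with h | ⟨⟨ω⟩⟩
        · have h1 := measure_univ (μ := P)
          rw [Set.univ_eq_empty_iff.2 h] at h1; simp at h1
        · exact Real.one_le_exp ((hb0 0 ω).trans (hbM 0 ω))
      have := hK 0 hn w hw hw0 (fun ω => (hw1 ω).trans hM)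
      simpa [hbz] using this
    | succ n ih =>
      intro hn
      have h1 := ih (by omega)
      have hwG : Measurable[G (n+1)] w := hw.mono (hG0 _) le_rfl
      have hbG : Measurable[G (n+1)] (b n) := (hb n).mono (hG1 _) le_rfl
      have h2 := hK (n+1) hn (fun ω => w ω * (Real.exp (b (n+1) ω) - Real.exp (b n ω)))
        (hwG.mul ((hb (n+1)).exp.sub hbG.exp))
        (fun ω => mul_nonneg (hw0 ω) (sub_nonneg.2 (Real.exp_le_exp.2 (hmono n ω))))
        (fun ω => by
          have e1 := Real.exp_le_exp.2 (hbM (n+1) ω)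
          have e2 := Real.exp_pos (b n ω)
          have e3 := Real.exp_le_exp.2 (hmono n ω)
          nlinarith [hw0 ω, hw1 ω])
      have e1 : ∫ ω, w ω * (Real.exp (b (n+1) ω) - Real.exp (b n ω)) ∂P
          = ∫ ω, w ω * Real.exp (b (n+1) ω) ∂P - ∫ ω, w ω * Real.exp (b n ω) ∂P := by
        rw [← integral_sub (hwe _) (hwe _)]
        congr 1; ext ω; ring
      have e2 : ∫ ω, w ω * (Real.exp (b (n+1) ω) - Real.exp (b n ω)) * (b N ω - b (n+1) ω) ∂P
          = ∫ ω, w ω * ((∑ i ∈ Finset.range (n+1),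
      Real.exp (b i ω) * (b (i+1) ω - b i ω)) + Real.exp (b (n+1) ω) * (b N ω - b (n+1) ω)) ∂P
          - ∫ ω, w ω * ((∑ i ∈ Finset.range n,
      Real.exp (b i ω) * (b (i+1) ω - b i ω)) + Real.exp (b n ω) * (b N ω - b n ω)) ∂P := by
        rw [← integral_sub (hTi _) (hTi _)]
        congr 1; ext ω; rw [Finset.sum_range_succ]; ring
      rw [e1, e2] at h2
      linarith
  simpa using key N le_rfl

lemma kh_riemann (h : ℝ → ℝ) (s t : ℝ) (hst : s ≤ t) (hc : ContinuousOn h (Set.Icc s t))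
    (hm : MonotoneOn h (Set.Icc s t)) :
    Filter.Tendsto (fun N : ℕ => ∑ i ∈ Finset.range N,
      Real.exp (h (s + (t - s) * min ((i:ℝ) / N) 1)) *
        (h (s + (t - s) * min (((i + 1 : ℕ):ℝ) / N) 1) - h (s + (t - s) * min ((i:ℝ) / N) 1)))
      Filter.atTop (nhds (Real.exp (h t) - Real.exp (h s))) := by
  set r : ℕ → ℕ → ℝ := fun N i => s + (t - s) * min ((i:ℝ) / N) 1 with hr
  have hmem : ∀ N i, r N i ∈ Set.Icc s t := fun N i => by
    have h1 : 0 ≤ min ((i:ℝ) / N) 1 := by positivity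
    have h2 : min ((i:ℝ) / N) 1 ≤ 1 := min_le_right _ _
    constructor <;> simp only [hr] <;> nlinarith
  have hrm : ∀ N i, r N i ≤ r N (i+1) := fun N i => by
    simp only [hr]
    have : (i:ℝ) / N ≤ ((i+1:ℕ):ℝ)/N := by push_cast; gcongr; linarith
    have := min_le_min_right 1 this
    nlinarith
  have hhm : ∀ N i, h (r N i) ≤ h (r N (i+1)) := fun N i => hm (hmem _ _) (hmem _ _) (hrm _ _)
  have hgap : ∀ N i, r N (i+1) - r N i ≤ (t - s) / N := fun N i => by
    simp only [hr]
    have h1 : ((i+1:ℕ):ℝ)/N = i / N + 1 / N := by push_cast; ring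
    have h2 : (0:ℝ) ≤ 1 / N := by positivity
    have h3 : min (((i+1:ℕ):ℝ)/N) 1 - min ((i:ℝ)/N) 1 ≤ 1 / N := by
      rw [h1]; rcases min_cases ((i:ℝ)/N) 1 with h | h <;> rcases min_cases ((i:ℝ)/N + 1 / N) 1 with h' | h' <;> linarith
    have := mul_le_mul_of_nonneg_left h3 (sub_nonneg.2 hst)
    calc _ = (t - s) * (min (((i+1:ℕ):ℝ)/N) 1 - min ((i:ℝ)/N) 1) := by ring
      _ ≤ _ := this
      _ = _ := by ring
  have htel : ∀ N : ℕ, 0 < N → ∑ i ∈ Finset.range N, (Real.exp (h (r N (i+1))) - Real.exp (h (r N i)))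
      = Real.exp (h t) - Real.exp (h s) := fun N hN => by
    rw [Finset.sum_range_sub (fun i => Real.exp (h (r N i)))]
    have : (N:ℝ) ≠ 0 := by positivity
    simp [hr, this]
  have hE : 0 ≤ Real.exp (h t) - Real.exp (h s) :=
    sub_nonneg.2 (Real.exp_le_exp.2 (hm ⟨le_rfl, hst⟩ ⟨hst, le_rfl⟩ hst))
  rw [Metric.tendsto_atTop]
  intro ε hε
  set L := Real.exp (h t) - Real.exp (h s) with hL
  obtain ⟨δ, hδ, hδL⟩ : ∃ δ > 0, (Real.exp δ - 1) * L < ε := by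
    have : Filter.Tendsto (fun δ => (Real.exp δ - 1) * L) (nhdsWithin 0 (Set.Ioi 0)) (nhds 0) := by
      have hcc : Continuous (fun δ => (Real.exp δ - 1) * L) := by fun_prop
      have := hcc.tendsto 0
      simp at this
      exact this.mono_left nhdsWithin_le_nhds
    have h1 := this.eventually (gt_mem_nhds hε)
    obtain ⟨δ, h2, h3⟩ := (h1.and self_mem_nhdsWithin).exists
    exact ⟨δ, h3, h2⟩
  have huc := isCompact_Icc.uniformContinuousOn_of_continuous hc
  rw [Metric.uniformContinuousOn_iff] at huc
  obtain ⟨η, hη, hu⟩ := huc δ hδ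
  obtain ⟨N0, hN0⟩ := exists_nat_gt ((t - s) / η)
  refine ⟨N0 + 1, fun N hN => ?_⟩
  have hNpos : 0 < N := by omega
  have hNr : (N0:ℝ) < N := by exact_mod_cast (by omega : N0 < N)
  have hNp : (0:ℝ) < N := by exact_mod_cast hNpos
  have hsm : (t - s) / N < η := by
    rw [div_lt_iff₀ hNp]; rw [div_lt_iff₀ hη] at hN0; nlinarith
  have hinc : ∀ i, h (r N (i+1)) - h (r N i) ≤ δ := fun i => by
    have := hu _ (hmem N (i+1)) _ (hmem N i) (by
      rw [Real.dist_eq, abs_of_nonneg (sub_nonneg.2 (hrm N i))]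
      exact (hgap N i).trans_lt hsm)
    rw [Real.dist_eq] at this
    exact (le_abs_self _).trans this.le
  have hup : ∑ i ∈ Finset.range N, Real.exp (h (r N i)) * (h (r N (i+1)) - h (r N i)) ≤ L := by
    rw [← htel N hNpos]
    refine Finset.sum_le_sum fun i _ => ?_
    have h1 := Real.add_one_le_exp (h (r N (i+1)) - h (r N i))
    have h2 : Real.exp (h (r N (i+1))) = Real.exp (h (r N i)) * Real.exp (h (r N (i+1)) - h (r N i)) := by
      rw [← Real.exp_add]; congr 1; ring
    rw [h2]; nlinarith [Real.exp_pos (h (r N i))]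
  have hlo : L ≤ Real.exp δ * ∑ i ∈ Finset.range N, Real.exp (h (r N i)) * (h (r N (i+1)) - h (r N i)) := by
    rw [← htel N hNpos, Finset.mul_sum]
    refine Finset.sum_le_sum fun i _ => ?_
    set x := h (r N i)
    set y := h (r N (i+1))
    have h1 := Real.add_one_le_exp (x - y)
    have h2 : Real.exp x = Real.exp y * Real.exp (x - y) := by
      rw [← Real.exp_add]; congr 1; ring
    have h3 : Real.exp y - Real.exp x ≤ Real.exp y * (y - x) := by
      rw [h2]; nlinarith [Real.exp_pos y]
    have h4 : Real.exp y ≤ Real.exp δ * Real.exp x := by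
      rw [← Real.exp_add]; exact Real.exp_le_exp.2 (by linarith [hinc i])
    have h5 : 0 ≤ y - x := sub_nonneg.2 (hhm N i)
    nlinarith [mul_le_mul_of_nonneg_right h4 h5]
  have h6 : 1 ≤ Real.exp δ := Real.one_le_exp hδ.le
  change dist (∑ i ∈ Finset.range N, Real.exp (h (r N i)) * (h (r N (i+1)) - h (r N i))) L < ε
  rw [Real.dist_eq, abs_sub_lt_iff]
  constructor
  · linarith
  · nlinarith [mul_le_mul_of_nonneg_left hup (sub_nonneg.2 h6)]
open MeasureTheory


lemma kh_trunc {Ω : Type*} {m0 : MeasurableSpace Ω} (P : Measure Ω) [IsProbabilityMeasure P]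
    (𝓕 : Filtration ℝ m0) (s t : ℝ) (hst : s ≤ t)
    (A : ℝ → Ω → ℝ) (C β : ℝ) (hC : 0 < C) (hβ : 0 < β)
    (hadapt : Adapted 𝓕 A)
    (hcont : ∀ ω, ContinuousOn (fun t => A t ω) (Set.Icc s t))
    (hmono : ∀ ω, MonotoneOn (fun t => A t ω) (Set.Icc s t))
    (hint : ∀ r ∈ Set.Icc s t, Integrable (A r) P)
    (hincr : ∀ r, s ≤ r → r ≤ t →
      ∀ᵐ ω ∂P, (P[A t - A r|𝓕 r]) ω ≤ C * (t - r) ^ β)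
    (lam : ℝ) (hlam : 0 < lam) (hsmall : lam * C * (t - s) ^ β ≤ 1 / 2) (M : ℝ) (hM : 0 ≤ M)
    (B : Set Ω) (hB : MeasurableSet[𝓕 s] B) :
    ∫ ω in B, Real.exp (min (lam * (A t ω - A s ω)) M) ∂P ≤ 2 * P.real B := by
  set h : Ω → ℝ → ℝ := fun ω u => min (lam * (A u ω - A s ω)) M with hh
  have hsI : s ∈ Set.Icc s t := ⟨le_rfl, hst⟩
  have htI : t ∈ Set.Icc s t := ⟨hst, le_rfl⟩
  have hhs : ∀ ω, h ω s = 0 := fun ω => by simp [hh, hM]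
  have hhc : ∀ ω, ContinuousOn (h ω) (Set.Icc s t) := fun ω =>
    ContinuousOn.inf (continuousOn_const.mul ((hcont ω).sub continuousOn_const)) continuousOn_const
  have hhm : ∀ ω, MonotoneOn (h ω) (Set.Icc s t) := fun ω x hx y hy hxy => by
    have := hmono ω hx hy hxy
    simp only at this
    exact min_le_min_right _ (mul_le_mul_of_nonneg_left (by linarith) hlam.le)
  have hh0 : ∀ ω, ∀ u ∈ Set.Icc s t, 0 ≤ h ω u := fun ω u hu => by
    rw [← hhs ω]; exact hhm ω hsI hu hu.1
  have hhM : ∀ ω u, h ω u ≤ M := fun ω u => min_le_right _ _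
  have hhmeas : ∀ u, s ≤ u → Measurable[𝓕 u] (fun ω => h ω u) := fun u hu => by
    have h1 : Measurable[𝓕 u] (A u) := hadapt u
    have h2 : Measurable[𝓕 u] (A s) := (hadapt s).mono (𝓕.mono hu) le_rfl
    exact ((h1.sub h2).const_mul lam).min measurable_const
  have hhme : ∀ u, s ≤ u → Measurable (fun ω => h ω u) := fun u hu =>
    (hhmeas u hu).mono (𝓕.le u) le_rfl
  have hBm : MeasurableSet B := 𝓕.le s _ hB
  set w : Ω → ℝ := B.indicator 1 with hw
  have hw0 : ∀ ω, 0 ≤ w ω := fun ω => Set.indicator_nonneg (fun _ _ => zero_le_one) ω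
  have hw1 : ∀ ω, w ω ≤ 1 := fun ω => Set.indicator_le_self' (fun _ _ => zero_le_one) ω
  have hwG : Measurable[𝓕 s] w := kh_ind_real hB
  have hwm : Measurable w := hwG.mono (𝓕.le s) le_rfl
  set K := lam * C * (t - s) ^ β with hK
  -- conditional bound
  have hcond : ∀ r ∈ Set.Icc s t, ∀ f : Ω → ℝ, Measurable[𝓕 r] f → (∀ ω, 0 ≤ f ω) →
      (∀ ω, f ω ≤ Real.exp M) →
      ∫ ω, f ω * (h ω t - h ω r) ∂P ≤ K * ∫ ω, f ω ∂P := by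
    intro r hr f hf hf0 hfc
    have hDi : Integrable (A t - A r) P := (hint t htI).sub (hint r hr)
    have hpow : C * (t - r) ^ β ≤ C * (t - s) ^ β := by
      have := hr.1
      have := hr.2
      gcongr
    have h1 := kh_condexp (𝓕 r) P (𝓕.le r) f (A t - A r) (Real.exp M) (C * (t - s) ^ β) hf hf0 hfc
      hDi (by filter_upwards [hincr r hr.1 hr.2] with ω hω using hω.trans hpow)
    have hfb : ∀ᵐ ω ∂P, ‖f ω‖ ≤ Real.exp M := Filter.Eventually.of_forall fun ω => by
      rw [Real.norm_eq_abs, abs_of_nonneg (hf0 ω)]; exact hfc ω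
    have hfm : AEStronglyMeasurable f P := (hf.mono (𝓕.le r) le_rfl).aestronglyMeasurable
    have hle : ∀ ω, h ω t - h ω r ≤ lam * (A t ω - A r ω) := fun ω => by
      have := hmono ω hr htI hr.2
      simp only at this
      have h3 : 0 ≤ lam * (A t ω - A r ω) := mul_nonneg hlam.le (by linarith)
      simp only [hh]
      rcases min_cases (lam * (A t ω - A s ω)) M with h | h <;>
        rcases min_cases (lam * (A r ω - A s ω)) M with h' | h' <;> nlinarith
    calc ∫ ω, f ω * (h ω t - h ω r) ∂P ≤ ∫ ω, lam * (f ω * (A t - A r) ω) ∂P := by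
          apply integral_mono_of_nonneg
          · exact Filter.Eventually.of_forall fun ω =>
              mul_nonneg (hf0 ω) (sub_nonneg.2 (hhm ω hr htI hr.2))
          · exact (hDi.bdd_mul hfm hfb).const_mul lam
          · refine Filter.Eventually.of_forall fun ω => ?_
            have := mul_le_mul_of_nonneg_left (hle ω) (hf0 ω)
            simp only [Pi.sub_apply]; linarith
      _ = lam * ∫ ω, f ω * (A t - A r) ω ∂P := integral_const_mul _ _
      _ ≤ lam * (C * (t - s) ^ β * ∫ ω, f ω ∂P) := mul_le_mul_of_nonneg_left h1 hlam.le
      _ = _ := by rw [hK]; ring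
  set r : ℕ → ℕ → ℝ := fun N i => s + (t - s) * min ((i:ℝ) / N) 1 with hr
  have hmem : ∀ N i, r N i ∈ Set.Icc s t := fun N i => by
    have h1 : 0 ≤ min ((i:ℝ) / N) 1 := by positivity
    have h2 : min ((i:ℝ) / N) 1 ≤ 1 := min_le_right _ _
    constructor <;> simp only [hr] <;> nlinarith
  have hrm : ∀ N i, r N i ≤ r N (i+1) := fun N i => by
    simp only [hr]
    have : (i:ℝ) / N ≤ ((i+1:ℕ):ℝ)/N := by push_cast; gcongr; linarith
    have := min_le_min_right 1 this
    nlinarith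
  have hr0 : ∀ N, r N 0 = s := fun N => by simp [hr]
  have hrN : ∀ N, 0 < N → r N N = t := fun N hN => by
    have : (N:ℝ) ≠ 0 := by positivity
    simp [hr, this]
  set S : ℕ → Ω → ℝ := fun N ω => ∑ i ∈ Finset.range N,
    Real.exp (h ω (r N i)) * (h ω (r N (i+1)) - h ω (r N i)) with hS
  have hdisc : ∀ N : ℕ, 0 < N → ∫ ω, w ω * S N ω ∂P ≤ K * ∫ ω, w ω * Real.exp (h ω t) ∂P := by
    intro N hN
    have := kh_discrete P (fun i => 𝓕 (r N i)) (fun i => 𝓕.le _)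
      (fun i => 𝓕.mono (by rw [hr0]; exact (hmem N i).1)) (fun i => 𝓕.mono (hrm N i)) N
      (fun i ω => h ω (r N i)) M K w (by rw [hr0]; exact hwG) hw0 hw1
      (fun i => hhmeas _ (hmem N i).1) (fun ω => by rw [hr0]; exact hhs ω)
      (fun i ω => hh0 ω _ (hmem N i)) (fun i ω => hhM ω _)
      (fun i ω => hhm ω (hmem _ _) (hmem _ _) (hrm N i))
      (fun i hi f hf hf0 hfc => by
        simp only [hrN N hN]
        exact hcond _ (hmem N i) f hf hf0 hfc)
    simp only [hrN N hN] at this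
    exact this
  have hSlim : ∀ ω, Filter.Tendsto (fun N => S N ω) Filter.atTop
      (nhds (Real.exp (h ω t) - 1)) := fun ω => by
    have := kh_riemann (h ω) s t hst (hhc ω) (hhm ω)
    rw [hhs ω, Real.exp_zero] at this
    exact this
  have hS0 : ∀ N ω, 0 ≤ S N ω := fun N ω => Finset.sum_nonneg fun i _ =>
    mul_nonneg (Real.exp_pos _).le (sub_nonneg.2 (hhm ω (hmem _ _) (hmem _ _) (hrm N i)))
  have hSM : ∀ N ω, S N ω ≤ Real.exp M * M := fun N ω => by
    calc S N ω ≤ ∑ i ∈ Finset.range N, Real.exp M * (h ω (r N (i+1)) - h ω (r N i)) := by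
          refine Finset.sum_le_sum fun i _ => ?_
          exact mul_le_mul_of_nonneg_right (Real.exp_le_exp.2 (hhM _ _))
            (sub_nonneg.2 (hhm ω (hmem _ _) (hmem _ _) (hrm N i)))
      _ = Real.exp M * (h ω (r N N) - h ω (r N 0)) := by
          rw [← Finset.mul_sum, Finset.sum_range_sub (fun i => h ω (r N i))]
      _ ≤ _ := by
          refine mul_le_mul_of_nonneg_left ?_ (Real.exp_pos _).le
          have := hh0 ω _ (hmem N 0)
          have := hhM ω (r N N)
          linarith
  have hlim : Filter.Tendsto (fun N => ∫ ω, w ω * S N ω ∂P) Filter.atTop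
      (nhds (∫ ω, w ω * (Real.exp (h ω t) - 1) ∂P)) := by
    refine tendsto_integral_of_dominated_convergence (fun _ => Real.exp M * M) ?_
      (integrable_const _) ?_ ?_
    · intro N
      refine (hwm.mul ?_).aestronglyMeasurable
      refine Finset.measurable_fun_sum _ fun i _ => ?_
      exact (hhme _ (hmem N i).1).exp.mul ((hhme _ (hmem N (i+1)).1).sub (hhme _ (hmem N i).1))
    · intro N
      refine Filter.Eventually.of_forall fun ω => ?_
      rw [Real.norm_eq_abs, abs_of_nonneg (mul_nonneg (hw0 ω) (hS0 N ω))]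
      nlinarith [hS0 N ω, hSM N ω, hw0 ω, hw1 ω]
    · exact Filter.Eventually.of_forall fun ω => (hSlim ω).const_mul _
  have hfin := le_of_tendsto hlim (Filter.eventually_atTop.2 ⟨1, fun N hN => hdisc N hN⟩)
  have hei : Integrable (fun ω => Real.exp (h ω t)) P :=
    Integrable.of_bound (hhme t hst).exp.aestronglyMeasurable (Real.exp M)
      (Filter.Eventually.of_forall fun ω => by
        rw [Real.norm_eq_abs, abs_of_nonneg (Real.exp_pos _).le]
        exact Real.exp_le_exp.2 (hhM ω t))
  have hwb : ∀ᵐ ω ∂P, ‖w ω‖ ≤ 1 := Filter.Eventually.of_forall fun ω => by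
    rw [Real.norm_eq_abs, abs_of_nonneg (hw0 ω)]; exact hw1 ω
  have hwi : Integrable w P := Integrable.of_bound hwm.aestronglyMeasurable 1 hwb
  have hwe : Integrable (fun ω => w ω * Real.exp (h ω t)) P :=
    hei.bdd_mul hwm.aestronglyMeasurable hwb
  have e1 : ∫ ω, w ω * (Real.exp (h ω t) - 1) ∂P = ∫ ω, w ω * Real.exp (h ω t) ∂P - P.real B := by
    have : ∫ ω, w ω ∂P = P.real B := integral_indicator_one hBm
    rw [← this, ← integral_sub hwe hwi]
    congr 1; ext ω; ring
  have e2 : ∫ ω in B, Real.exp (h ω t) ∂P = ∫ ω, w ω * Real.exp (h ω t) ∂P := by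
    rw [← integral_indicator hBm]
    congr 1; ext ω
    by_cases hω : ω ∈ B <;> simp [hw, hω]
  have e3 : 0 ≤ ∫ ω, w ω * Real.exp (h ω t) ∂P :=
    integral_nonneg fun ω => mul_nonneg (hw0 ω) (Real.exp_pos _).le
  change ∫ ω in B, Real.exp (h ω t) ∂P ≤ _
  rw [e2]
  rw [e1] at hfin
  nlinarith [mul_le_mul_of_nonneg_right hsmall e3]

lemma kh_step {Ω : Type*} {m0 : MeasurableSpace Ω} (P : Measure Ω) [IsProbabilityMeasure P]
    (𝓕 : Filtration ℝ m0) (s t : ℝ) (hst : s ≤ t)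
    (A : ℝ → Ω → ℝ) (C β : ℝ) (hC : 0 < C) (hβ : 0 < β)
    (hadapt : Adapted 𝓕 A)
    (hcont : ∀ ω, ContinuousOn (fun t => A t ω) (Set.Icc s t))
    (hmono : ∀ ω, MonotoneOn (fun t => A t ω) (Set.Icc s t))
    (hint : ∀ r ∈ Set.Icc s t, Integrable (A r) P)
    (hincr : ∀ r, s ≤ r → r ≤ t →
      ∀ᵐ ω ∂P, (P[A t - A r|𝓕 r]) ω ≤ C * (t - r) ^ β)
    (lam : ℝ) (hlam : 0 < lam) (hsmall : lam * C * (t - s) ^ β ≤ 1 / 2)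
    (f : Ω → ENNReal) (hf : Measurable[𝓕 s] f) :
    ∫⁻ ω, f ω * ENNReal.ofReal (Real.exp (lam * (A t ω - A s ω))) ∂P ≤ 2 * ∫⁻ ω, f ω ∂P := by
  have hAm : ∀ u, Measurable (A u) := fun u => (hadapt u).mono (𝓕.le u) le_rfl
  have hset : ∀ B, MeasurableSet[𝓕 s] B →
      ∫⁻ ω in B, ENNReal.ofReal (Real.exp (lam * (A t ω - A s ω))) ∂P ≤ 2 * P B := by
    intro B hB
    have hM : ∀ M : ℕ, ∫⁻ ω in B, ENNReal.ofReal (Real.exp (min (lam * (A t ω - A s ω)) M)) ∂P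
        ≤ 2 * P B := by
      intro M
      have h1 := kh_trunc P 𝓕 s t hst A C β hC hβ hadapt hcont hmono hint hincr lam hlam hsmall M
        (Nat.cast_nonneg M) B hB
      have hmm : Measurable fun ω => Real.exp (min (lam * (A t ω - A s ω)) M) :=
        ((((hAm t).sub (hAm s)).const_mul lam).min measurable_const).exp
      have hi : Integrable (fun ω => Real.exp (min (lam * (A t ω - A s ω)) M)) (P.restrict B) :=
        Integrable.of_bound hmm.aestronglyMeasurable (Real.exp M)
          (Filter.Eventually.of_forall fun ω => by
            rw [Real.norm_eq_abs, abs_of_nonneg (Real.exp_pos _).le]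
            exact Real.exp_le_exp.2 (min_le_right _ _))
      rw [← ofReal_integral_eq_lintegral_ofReal hi
        (Filter.Eventually.of_forall fun ω => (Real.exp_pos _).le)]
      calc _ ≤ ENNReal.ofReal (2 * P.real B) := ENNReal.ofReal_le_ofReal h1
        _ = 2 * P B := by
          rw [ENNReal.ofReal_mul (by norm_num), ofReal_measureReal]; simp
    have hlim : ∀ ω, Filter.liminf (fun M : ℕ =>
        ENNReal.ofReal (Real.exp (min (lam * (A t ω - A s ω)) M))) Filter.atTop
        = ENNReal.ofReal (Real.exp (lam * (A t ω - A s ω))) := fun ω => by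
      apply Filter.Tendsto.liminf_eq
      obtain ⟨M0, hM0⟩ := exists_nat_ge (lam * (A t ω - A s ω))
      refine tendsto_atTop_of_eventually_const (i₀ := M0) fun M hM => ?_
      rw [min_eq_left (hM0.trans (by exact_mod_cast hM))]
    calc ∫⁻ ω in B, ENNReal.ofReal (Real.exp (lam * (A t ω - A s ω))) ∂P
        = ∫⁻ ω in B, Filter.liminf (fun M : ℕ =>
        ENNReal.ofReal (Real.exp (min (lam * (A t ω - A s ω)) M))) Filter.atTop ∂P := by
          simp_rw [hlim]
      _ ≤ Filter.liminf (fun M : ℕ => ∫⁻ ω in B,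
        ENNReal.ofReal (Real.exp (min (lam * (A t ω - A s ω)) M)) ∂P) Filter.atTop := by
          apply lintegral_liminf_le
          intro M
          exact ((((hAm t).sub (hAm s)).const_mul lam).min measurable_const).exp.ennreal_ofReal
      _ ≤ 2 * P B := by
          refine (Filter.liminf_le_liminf (Filter.Eventually.of_forall hM)).trans ?_
          simp
  have hgm : Measurable fun ω => ENNReal.ofReal (Real.exp (lam * (A t ω - A s ω))) :=
    (((hAm t).sub (hAm s)).const_mul lam).exp.ennreal_ofReal
  have hle : (P.withDensity fun ω => ENNReal.ofReal (Real.exp (lam * (A t ω - A s ω)))).trim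
      (𝓕.le s) ≤ ((2 : ENNReal) • P).trim (𝓕.le s) := by
    refine Measure.le_iff.2 fun B hB => ?_
    rw [trim_measurableSet_eq _ hB, trim_measurableSet_eq _ hB, withDensity_apply _ (𝓕.le s _ hB)]
    simpa using hset B hB
  have h1 := lintegral_mono' hle (le_refl f)
  rw [lintegral_trim _ hf, lintegral_trim _ hf, lintegral_smul_measure,
    lintegral_withDensity_eq_lintegral_mul _ hgm (hf.mono (𝓕.le s) le_rfl)] at h1
  simpa [mul_comm] using h1

/-- Khasminskii's exponential estimate. -/
theorem stmt14 {Ω : Type*} {m0 : MeasurableSpace Ω} (P : Measure Ω) [IsProbabilityMeasure P]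
    (𝓕 : Filtration ℝ m0) (t₀ t₁ : ℝ) (h01 : t₀ < t₁)
    (A : ℝ → Ω → ℝ) (C β : ℝ) (hC : 0 < C) (hβ : 0 < β)
    (hadapt : Adapted 𝓕 A)
    (hcont : ∀ ω, ContinuousOn (fun t => A t ω) (Set.Icc t₀ t₁))
    (hmono : ∀ ω, MonotoneOn (fun t => A t ω) (Set.Icc t₀ t₁))
    (h0 : ∀ ω, A t₀ ω = 0)
    (hint : ∀ t ∈ Set.Icc t₀ t₁, Integrable (A t) P)
    (hincr : ∀ s t, t₀ ≤ s → s ≤ t → t ≤ t₁ →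
      ∀ᵐ ω ∂P, (P[A t - A s|𝓕 s]) ω ≤ C * (t - s) ^ β) :
    ∀ lam > (0 : ℝ),
      (∀ᵐ ω ∂P, (P[fun ω => Real.exp (lam * A t₁ ω)|𝓕 t₀]) ω ≤
        (2 : ℝ) ^ ((t₁ - t₀) * (2 * C * lam) ^ (1 / β) + 1)) ∧
      ∀ n : ℕ, 0 < n → lam * C * ((t₁ - t₀) / n) ^ β ≤ 1 / 2 →
        ∀ᵐ ω ∂P, (P[fun ω => Real.exp (lam * A t₁ ω)|𝓕 t₀]) ω ≤ (2 : ℝ) ^ n := by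
  intro lam hlam
  have hAm : ∀ u, Measurable (A u) := fun u => (hadapt u).mono (𝓕.le u) le_rfl
  have main : ∀ n : ℕ, 0 < n → lam * C * ((t₁ - t₀) / n) ^ β ≤ 1 / 2 →
        ∀ᵐ ω ∂P, (P[fun ω => Real.exp (lam * A t₁ ω)|𝓕 t₀]) ω ≤ (2 : ℝ) ^ n := by
    intro n hn hsm
    have hnp : (0:ℝ) < n := by exact_mod_cast hn
    set d := (t₁ - t₀) / n with hd
    have hdp : 0 < d := div_pos (by linarith) hnp
    have hnd : n * d = t₁ - t₀ := by rw [hd]; field_simp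
    have hset : ∀ B, MeasurableSet[𝓕 t₀] B → ∀ k : ℕ, k ≤ n →
        ∫⁻ ω, B.indicator 1 ω * ENNReal.ofReal (Real.exp (lam * A (t₀ + k * d) ω)) ∂P
          ≤ 2 ^ k * P B := by
      intro B hB k
      induction k with
      | zero =>
        intro _
        simp [h0, lintegral_indicator_one (𝓕.le t₀ _ hB)]
      | succ k ih =>
        intro hk
        have hk' : ((k + 1 : ℕ) : ℝ) ≤ n := by exact_mod_cast hk
        have hk0 : (0:ℝ) ≤ k := Nat.cast_nonneg k
        push_cast at hk'
        set s := t₀ + k * d with hs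
        have ht : t₀ + ((k + 1 : ℕ) : ℝ) * d = s + d := by rw [hs]; push_cast; ring
        rw [ht]
        have hs0 : t₀ ≤ s := by rw [hs]; nlinarith
        have ht1 : s + d ≤ t₁ := by rw [hs]; nlinarith
        have hsub : Set.Icc s (s + d) ⊆ Set.Icc t₀ t₁ := Set.Icc_subset_Icc hs0 ht1
        have hf : Measurable[𝓕 s] fun ω =>
            B.indicator (1 : Ω → ENNReal) ω * ENNReal.ofReal (Real.exp (lam * A s ω)) := by
          have h1 : Measurable[𝓕 s] (B.indicator (1 : Ω → ENNReal)) :=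
            kh_ind_ennreal (𝓕.mono hs0 _ hB)
          have h2 : Measurable[𝓕 s] (A s) := hadapt s
          exact h1.mul (h2.const_mul lam).exp.ennreal_ofReal
        have := kh_step P 𝓕 s (s + d) (by linarith) A C β hC hβ hadapt
          (fun ω => (hcont ω).mono hsub) (fun ω => (hmono ω).mono hsub)
          (fun r hr => hint r (hsub hr))
          (fun r h1 h2 => hincr r (s + d) (hs0.trans h1) h2 ht1) lam hlam
          (by simpa using hsm) _ hf
        calc _ = _ := by
              refine lintegral_congr fun ω => ?_
              rw [show lam * A (s + d) ω = lam * A s ω + lam * (A (s + d) ω - A s ω) by ring,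
                Real.exp_add, ENNReal.ofReal_mul (Real.exp_pos _).le, ← mul_assoc]
          _ ≤ _ := this
          _ ≤ 2 * (2 ^ k * P B) := by gcongr; exact ih (by omega)
          _ = _ := by rw [pow_succ]; ring
    have hset' : ∀ B, MeasurableSet[𝓕 t₀] B →
        ∫⁻ ω in B, ENNReal.ofReal (Real.exp (lam * A t₁ ω)) ∂P ≤ 2 ^ n * P B := by
      intro B hB
      have := hset B hB n le_rfl
      rw [hnd, show t₀ + (t₁ - t₀) = t₁ by ring] at this
      rw [← lintegral_indicator (𝓕.le t₀ _ hB)]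
      refine le_trans (le_of_eq (lintegral_congr fun ω => ?_)) this
      by_cases hω : ω ∈ B <;> simp [hω]
    have hmeas : Measurable fun ω => Real.exp (lam * A t₁ ω) := ((hAm t₁).const_mul lam).exp
    have hi : Integrable (fun ω => Real.exp (lam * A t₁ ω)) P := by
      refine ⟨hmeas.aestronglyMeasurable, ?_⟩
      rw [hasFiniteIntegral_iff_ofReal (Filter.Eventually.of_forall fun ω => (Real.exp_pos _).le)]
      have := hset' Set.univ MeasurableSet.univ
      rw [Measure.restrict_univ, measure_univ, mul_one] at this
      exact this.trans_lt (by finiteness)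
    apply ae_le_of_ae_le_trim (hm := 𝓕.le t₀) (f₁ := P[fun ω => Real.exp (lam * A t₁ ω)|𝓕 t₀])
      (f₂ := fun _ => (2:ℝ) ^ n)
    apply ae_le_of_forall_setIntegral_le
    · exact integrable_condExp.trim (𝓕.le t₀) stronglyMeasurable_condExp
    · exact integrable_const _
    · intro B hB _
      rw [← setIntegral_trim (𝓕.le t₀) stronglyMeasurable_condExp hB,
        setIntegral_condExp (𝓕.le t₀) hi hB, setIntegral_const,
        integral_eq_lintegral_of_nonneg_ae (Filter.Eventually.of_forall fun ω => (Real.exp_pos _).le)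
          hmeas.aestronglyMeasurable, Measure.real, trim_measurableSet_eq _ hB]
      have := ENNReal.toReal_mono (by finiteness) (hset' B hB)
      simpa [mul_comm] using this
  refine ⟨?_, main⟩
  set x := (t₁ - t₀) * (2 * C * lam) ^ (1 / β) with hx
  have hT : 0 < t₁ - t₀ := by linarith
  have hxp : 0 < x := by positivity
  have hn : 0 < ⌈x⌉₊ := Nat.ceil_pos.2 hxp
  have hnp : (0:ℝ) < ⌈x⌉₊ := by exact_mod_cast hn
  have hb : lam * C * ((t₁ - t₀) / ⌈x⌉₊) ^ β ≤ 1 / 2 := by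
    have h1 : (t₁ - t₀) / ⌈x⌉₊ ≤ (t₁ - t₀) / x :=
      div_le_div_of_nonneg_left hT.le hxp (Nat.le_ceil x)
    have h2 : (t₁ - t₀) / x = ((2 * C * lam) ^ (1 / β))⁻¹ := by
      rw [hx]; field_simp
    have h3 : ((t₁ - t₀) / ⌈x⌉₊) ^ β ≤ (2 * C * lam)⁻¹ := by
      calc _ ≤ ((t₁ - t₀) / x) ^ β := by gcongr
        _ = _ := by
          rw [h2, Real.inv_rpow (by positivity), ← Real.rpow_mul (by positivity),
            one_div_mul_cancel hβ.ne', Real.rpow_one]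
    calc _ ≤ lam * C * (2 * C * lam)⁻¹ := by gcongr
      _ = 1 / 2 := by field_simp
  filter_upwards [main _ hn hb] with ω hω
  refine hω.trans ?_
  rw [← Real.rpow_natCast]
  exact Real.rpow_le_rpow_of_exponent_le (by norm_num) (Nat.ceil_lt_add_one hxp.le).le
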